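/- The index set EXL* = {e : e codes a u.c.e. family that is TxtEx*-learnable by some learner} is Σ⁰₅-hard: every Σ⁰₅ set many-one reduces to EXL* via a computable function. -/

import Mathlib

/-- `Wset e` is the `e`-th computably enumerable set: the domain of the `e`-th
partial computable function in the standard numbering by codes. -/
def Wset (e : ℕ) : Set ℕ :=
  {x | ((Denumerable.ofNat Nat.Partrec.Code e).eval x).Dom}

/-- The `i`-th column `{x : ⟨i,x⟩ ∈ W_a}` of the c.e. set coded by `a`;
the number `a` codes the u.c.e. family whose members are its columns. -/
def column (a i : ℕ) : Set ℕ := {x | Nat.pair i x ∈ Wset a}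

/-- The initial segment of length `n` of an enumeration `f`. -/
def initSeg (f : ℕ → ℕ) (n : ℕ) : List ℕ := (List.range n).map f

/-- The `m`-th computable learner in the standard effective enumeration of all
partial computable functions from finite sequences to ℕ. -/
def learnerOfCode (m : ℕ) : List ℕ →. ℕ :=
  fun σ => (Denumerable.ofNat Nat.Partrec.Code m).eval (Encodable.encode σ)

/-- `M` TxtFin-identifies the enumeration `f` (here `Option.none` plays the
role of the symbol `?`). -/
def TxtFinIdentifies (M : List ℕ →. Option ℕ) (f : ℕ → ℕ) : Prop :=
  ∃ n h, (∀ n' < n, M (initSeg f n') = Part.some Option.none) ∧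
    M (initSeg f n) = Part.some (Option.some h) ∧ Wset h = Set.range f

/-- `M` TxtFin-learns the set `S`. -/
def TxtFinLearnsSet (M : List ℕ →. Option ℕ) (S : Set ℕ) : Prop :=
  ∀ f : ℕ → ℕ, Set.range f = S → TxtFinIdentifies M f

/-- `M` TxtEx-identifies the enumeration `f`. -/
def TxtExIdentifies (M : List ℕ →. ℕ) (f : ℕ → ℕ) : Prop :=
  ∃ n, (∃ N, ∀ i ≥ N, M (initSeg f i) = Part.some n) ∧ Wset n = Set.range f

/-- `M` TxtEx-learns the set `S`. -/
def TxtExLearnsSet (M : List ℕ →. ℕ) (S : Set ℕ) : Prop :=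
  ∀ f : ℕ → ℕ, Set.range f = S → TxtExIdentifies M f

/-- `M` TxtBC-identifies the enumeration `f`. -/
def TxtBCIdentifies (M : List ℕ →. ℕ) (f : ℕ → ℕ) : Prop :=
  ∃ N, ∀ i ≥ N, ∃ h, M (initSeg f i) = Part.some h ∧ Wset h = Set.range f

/-- `M` TxtBC-learns the set `S`. -/
def TxtBCLearnsSet (M : List ℕ →. ℕ) (S : Set ℕ) : Prop :=
  ∀ f : ℕ → ℕ, Set.range f = S → TxtBCIdentifies M f

/-- `M` TxtEx*-identifies the enumeration `f`. -/
def TxtExStarIdentifies (M : List ℕ →. ℕ) (f : ℕ → ℕ) : Prop :=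
  ∃ n, (∃ N, ∀ i ≥ N, M (initSeg f i) = Part.some n) ∧
    (symmDiff (Wset n) (Set.range f)).Finite

/-- `M` TxtEx*-learns the set `S`. -/
def TxtExStarLearnsSet (M : List ℕ →. ℕ) (S : Set ℕ) : Prop :=
  ∀ f : ℕ → ℕ, Set.range f = S → TxtExStarIdentifies M f

/-- Indices of cofinite c.e. sets. -/
def COF : Set ℕ := {e | (Wset e)ᶜ.Finite}

/-- Indices of coinfinite c.e. sets. -/
def COINF : Set ℕ := {e | (Wset e)ᶜ.Infinite}

/-- `P` is Σ⁰₃: definable by `∃∀∃` over a computable relation. -/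
def IsSigma3 (P : Set ℕ) : Prop :=
  ∃ R : ℕ → ℕ → ℕ → ℕ → Bool,
    Computable (fun p : ℕ × ℕ × ℕ × ℕ => R p.1 p.2.1 p.2.2.1 p.2.2.2) ∧
    ∀ e, e ∈ P ↔ ∃ x, ∀ y, ∃ z, R e x y z = true

/-- `P` is Σ⁰₄: definable by `∃∀∃∀` over a computable relation. -/
def IsSigma4 (P : Set ℕ) : Prop :=
  ∃ R : ℕ → ℕ → ℕ → ℕ → ℕ → Bool,
    Computable (fun p : ℕ × ℕ × ℕ × ℕ × ℕ =>
      R p.1 p.2.1 p.2.2.1 p.2.2.2.1 p.2.2.2.2) ∧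
    ∀ e, e ∈ P ↔ ∃ x, ∀ y, ∃ z, ∀ w, R e x y z w = true

/-- `P` is Σ⁰₅: definable by `∃∀∃∀∃` over a computable relation. -/
def IsSigma5 (P : Set ℕ) : Prop :=
  ∃ R : ℕ → ℕ → ℕ → ℕ → ℕ → ℕ → Bool,
    Computable (fun p : ℕ × ℕ × ℕ × ℕ × ℕ × ℕ =>
      R p.1 p.2.1 p.2.2.1 p.2.2.2.1 p.2.2.2.2.1 p.2.2.2.2.2) ∧
    ∀ e, e ∈ P ↔ ∃ x, ∀ y, ∃ z, ∀ w, ∃ v, R e x y z w v = true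

/-- `f : ℕ → ℕ` is Δ⁰₂: the pointwise limit of a computable function. -/
def IsDelta2Fun (f : ℕ → ℕ) : Prop :=
  ∃ g : ℕ → ℕ → ℕ, Computable₂ g ∧ ∀ x, ∃ s₀, ∀ s ≥ s₀, g s x = f x

/-- The index set of codes of TxtEx*-learnable u.c.e. families. -/
def EXLstar : Set ℕ :=
  {e | ∃ M : List ℕ →. ℕ, Partrec M ∧ ∀ i, TxtExStarLearnsSet M (column e i)}

/-- The triples at which the certificate `L` claims that `ρ` holds. Here a certificate `L` assigns to
each `i < L.length` the claim that `y = L[i].length` is least with `∀ z, ρ i y z`, the entry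
`L[i][y']` being the least counterexample for `y' < y`. -/
def certPos (L : List (List ℕ)) (i y z : ℕ) : Bool :=
  (L[i]?.map fun l => decide (l.length = y) ||
    (l[y]?.map fun b => decide (z < b)).getD false).getD false

/-- The triples at which the certificate `L` claims that `ρ` fails. -/
def certNeg (L : List (List ℕ)) (i y z : ℕ) : Bool :=
  decide ((L[i]?.bind fun l => l[y]?) = some z)

/-- All claims made by the certificate `L` about `ρ` are true. -/
def CertValid (ρ : ℕ → ℕ → ℕ → Prop) (L : List (List ℕ)) : Prop :=
  ∀ i y z, (certPos L i y z = true → ρ i y z) ∧ (certNeg L i y z = true → ¬ ρ i y z)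

theorem certPos_iff {L : List (List ℕ)} {i y z : ℕ} : certPos L i y z = true ↔
    ∃ l, L[i]? = some l ∧ (l.length = y ∨ ∃ b, l[y]? = some b ∧ z < b) := by
  unfold certPos
  cases h : L[i]? with
  | none => simp
  | some l => cases h' : l[y]? <;> simp [h']

theorem certNeg_iff {L : List (List ℕ)} {i y z : ℕ} : certNeg L i y z = true ↔
    ∃ l, L[i]? = some l ∧ l[y]? = some z := by
  unfold certNeg
  cases h : L[i]? <;> simp

theorem CertValid.spec {ρ : ℕ → ℕ → ℕ → Prop} {L : List (List ℕ)} (h : CertValid ρ L)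
    {i : ℕ} {l : List ℕ} (hc : L[i]? = some l) :
    (∀ z, ρ i l.length z) ∧
      ∀ y b, l[y]? = some b → ¬ ρ i y b ∧ ∀ z < b, ρ i y z :=
  ⟨fun z => (h i _ z).1 (certPos_iff.2 ⟨l, hc, Or.inl rfl⟩), fun y b hb =>
    ⟨(h i y b).2 (certNeg_iff.2 ⟨l, hc, hb⟩),
      fun z hz => (h i y z).1 (certPos_iff.2 ⟨l, hc, Or.inr ⟨b, hb, hz⟩⟩)⟩⟩

theorem CertValid.entry_unique {ρ : ℕ → ℕ → ℕ → Prop} {L L' : List (List ℕ)}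
    (h : CertValid ρ L) (h' : CertValid ρ L') {i : ℕ} {l l' : List ℕ}
    (hc : L[i]? = some l) (hc' : L'[i]? = some l') : l = l' := by
  obtain ⟨h1, h2⟩ := h.spec hc
  obtain ⟨h1', h2'⟩ := h'.spec hc'
  have hlen : l.length = l'.length := by
    rcases lt_trichotomy l.length l'.length with hl | hl | hl
    · exact absurd (h1 _) (h2' _ _ (List.getElem?_eq_getElem hl)).1
    · exact hl
    · exact absurd (h1' _) (h2 _ _ (List.getElem?_eq_getElem hl)).1
  refine List.ext_getElem hlen fun y hy hy' => ?_
  obtain ⟨a, b⟩ := h2 _ _ (List.getElem?_eq_getElem hy)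
  obtain ⟨a', b'⟩ := h2' _ _ (List.getElem?_eq_getElem hy')
  rcases lt_trichotomy (l[y]) (l'[y]) with hl | hl | hl
  · exact absurd (b' _ hl) a
  · exact hl
  · exact absurd (b _ hl) a'

theorem CertValid.eq_of_length_eq {ρ : ℕ → ℕ → ℕ → Prop} {L L' : List (List ℕ)}
    (h : CertValid ρ L) (h' : CertValid ρ L') (hl : L.length = L'.length) : L = L' :=
  List.ext_getElem hl fun _ hi hi' =>
    h.entry_unique h' (List.getElem?_eq_getElem hi) (List.getElem?_eq_getElem hi')

/-- The entry of a certificate: its length is the least `y` with `∀ z, σ y z`, and its members are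
the least counterexamples for smaller `y`. -/
theorem exists_cert_entry {σ : ℕ → ℕ → Prop} (h : ∃ y, ∀ z, σ y z) :
    ∃ l : List ℕ, (∀ z, σ l.length z) ∧
      ∀ y b, l[y]? = some b → ¬ σ y b ∧ ∀ z < b, σ y z := by
  classical
  have key : ∀ y, ∃ b, y < Nat.find h → ¬ σ y b ∧ ∀ z < b, σ y z := by
    intro y
    by_cases hy : y < Nat.find h
    · have hb := Nat.find_min h hy
      push Not at hb
      exact ⟨Nat.find hb, fun _ => ⟨Nat.find_spec hb, fun z hz => not_not.1 (Nat.find_min hb hz)⟩⟩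
    · exact ⟨0, fun hy' => absurd hy' hy⟩
  choose b hb using key
  refine ⟨(List.range (Nat.find h)).map b, by simpa using Nat.find_spec h, fun y b' hy => ?_⟩
  simp only [List.getElem?_map, Option.map_eq_some_iff, List.getElem?_eq_some_iff] at hy
  obtain ⟨a, ⟨h1, h2⟩, rfl⟩ := hy
  simp only [List.length_range, List.getElem_range] at h1 h2
  subst h2
  exact hb y h1

/-- A `∀∃∀` statement about `ρ` holds iff there are infinitely many valid certificates. -/
theorem forall_exists_forall_iff_infinite (ρ : ℕ → ℕ → ℕ → Prop) :
    (∀ i, ∃ y, ∀ z, ρ i y z) ↔ {L | CertValid ρ L}.Infinite := by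
  constructor
  · intro h
    choose l h1 h2 using fun i => exists_cert_entry (h i)
    refine Set.infinite_of_injective_forall_mem
      (f := fun k => (List.range k).map l) (fun a b hab => ?_) fun k i y z => ?_
    · simpa using congrArg List.length hab
    · constructor
      · intro hp
        obtain ⟨l', hc', h⟩ := certPos_iff.1 hp
        simp only [List.getElem?_map, Option.map_eq_some_iff, List.getElem?_eq_some_iff] at hc'
        obtain ⟨a, ⟨ha, ha'⟩, rfl⟩ := hc'
        simp only [List.getElem_range] at ha'
        subst ha'
        rcases h with rfl | ⟨b, hb, hz⟩
        · exact h1 _ z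
        · exact (h2 _ _ _ hb).2 z hz
      · intro hn
        obtain ⟨l', hc', h⟩ := certNeg_iff.1 hn
        simp only [List.getElem?_map, Option.map_eq_some_iff, List.getElem?_eq_some_iff] at hc'
        obtain ⟨a, ⟨ha, ha'⟩, rfl⟩ := hc'
        simp only [List.getElem_range] at ha'
        subst ha'
        exact (h2 _ _ _ h).1
  · intro h i
    by_contra hi
    refine h (Set.Finite.of_finite_image ((Set.finite_Iic i).subset ?_)
      (f := List.length) fun L hL L' hL' hl => CertValid.eq_of_length_eq hL hL' hl)
    rintro _ ⟨L, hL, rfl⟩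
    by_contra hlt
    simp only [Set.mem_Iic, not_le] at hlt
    exact hi ⟨_, (CertValid.spec hL (List.getElem?_eq_getElem hlt)).1⟩

theorem primrec_certPos :
    Primrec fun p : List (List ℕ) × ℕ × ℕ × ℕ => certPos p.1 p.2.1 p.2.2.1 p.2.2.2 := by
  unfold certPos
  refine Primrec.option_getD.comp (Primrec.option_map
    (Primrec.list_getElem?.comp Primrec.fst (Primrec.fst.comp Primrec.snd)) ?_)
    (Primrec.const false)
  refine Primrec.or.comp
    (Primrec.eq.comp (Primrec.list_length.comp Primrec.snd)
      (Primrec.fst.comp (Primrec.snd.comp (Primrec.snd.comp Primrec.fst)))).decide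
    (Primrec.option_getD.comp (Primrec.option_map
      (Primrec.list_getElem?.comp Primrec.snd
        (Primrec.fst.comp (Primrec.snd.comp (Primrec.snd.comp Primrec.fst)))) ?_)
      (Primrec.const false))
  exact (Primrec.nat_lt.comp (Primrec.snd.comp (Primrec.snd.comp (Primrec.snd.comp
    (Primrec.fst.comp Primrec.fst)))) Primrec.snd).decide

theorem primrec_certNeg :
    Primrec fun p : List (List ℕ) × ℕ × ℕ × ℕ => certNeg p.1 p.2.1 p.2.2.1 p.2.2.2 := by
  unfold certNeg
  have hz : Primrec fun p : List (List ℕ) × ℕ × ℕ × ℕ => p.2.2.2 :=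
    Primrec.snd.comp (Primrec.snd.comp Primrec.snd)
  refine (Primrec.eq.comp (Primrec.option_bind
    (Primrec.list_getElem?.comp Primrec.fst (Primrec.fst.comp Primrec.snd)) ?_)
    (Primrec.option_some.comp hz)).decide
  exact Primrec.list_getElem?.comp Primrec.snd
    (Primrec.fst.comp (Primrec.snd.comp (Primrec.snd.comp Primrec.fst)))

/-- The claims of the certificate coded by `n` at the triple `(i, y, z)` agree with the truth
value `a` (for the positive claims) and with the truth value `b` (for the negative claims). -/
def certCheck (n i y z : ℕ) (a b : Bool) : Bool :=
  (!certPos (Denumerable.ofNat _ n) i y z || a) && (!certNeg (Denumerable.ofNat _ n) i y z || b)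

theorem certCheck_iff {n i y z : ℕ} {a b : Bool} : certCheck n i y z a b = true ↔
    (certPos (Denumerable.ofNat _ n) i y z = true → a = true) ∧
      (certNeg (Denumerable.ofNat _ n) i y z = true → b = true) := by
  unfold certCheck
  cases certPos (Denumerable.ofNat _ n) i y z <;> cases certNeg (Denumerable.ofNat _ n) i y z <;>
    simp

theorem Computable.certCheck {α : Type*} [Primcodable α] {n i y z : α → ℕ} {a b : α → Bool}
    (hn : Computable n) (hi : Computable i) (hy : Computable y) (hz : Computable z)
    (ha : Computable a) (hb : Computable b) :
    Computable fun x => certCheck (n x) (i x) (y x) (z x) (a x) (b x) := by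
  have ht : Computable fun x => (Denumerable.ofNat (List (List ℕ)) (n x), i x, y x, z x) :=
    ((Computable.ofNat _).comp hn).pair (hi.pair (hy.pair hz))
  exact Primrec.and.to_comp.comp
    (Primrec.or.to_comp.comp (Primrec.not.to_comp.comp (primrec_certPos.to_comp.comp ht)) ha)
    (Primrec.or.to_comp.comp (Primrec.not.to_comp.comp (primrec_certNeg.to_comp.comp ht)) hb)

theorem infinite_setOf_ofNat {α : Type*} [Denumerable α] (p : α → Prop) :
    {n | p (Denumerable.ofNat α n)}.Infinite ↔ {a | p a}.Infinite := by
  rw [← Set.infinite_image_iff (f := (Denumerable.eqv α).symm)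
    (Denumerable.eqv α).symm.injective.injOn, Equiv.image_eq_preimage_symm]
  simp [Denumerable.eqv, Set.preimage]

/-- Every `Σ⁰₅` set is the set of `e` such that all but finitely many members of a sequence of
sets, c.e. uniformly in `e`, are cofinite. -/
theorem IsSigma5.exists_cofinite_form {P : Set ℕ} (hP : IsSigma5 P) :
    ∃ E : ℕ → ℕ → ℕ → ℕ → Bool,
      Computable (fun p : ℕ × ℕ × ℕ × ℕ => E p.1 p.2.1 p.2.2.1 p.2.2.2) ∧
      ∀ e, e ∈ P ↔ {n | {k | ∀ t, E e n k t = false}.Infinite}.Finite := by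
  obtain ⟨R, hR, hPR⟩ := hP
  let B : ℕ → ℕ → ℕ → ℕ → ℕ → Bool := fun e n q u v =>
    certCheck n q.unpair.1 q.unpair.2.unpair.1 q.unpair.2.unpair.2.unpair.1
      (!R e q.unpair.1 q.unpair.2.unpair.1 q.unpair.2.unpair.2.unpair.1 u.unpair.1 v)
      (R e q.unpair.1 q.unpair.2.unpair.1 q.unpair.2.unpair.2.unpair.1
        q.unpair.2.unpair.2.unpair.2 u.unpair.2)
  have hu1 : Computable fun n : ℕ => n.unpair.1 := Computable.fst.comp Computable.unpair
  have hu2 : Computable fun n : ℕ => n.unpair.2 := Computable.snd.comp Computable.unpair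
  have hB : Computable fun p : ℕ × ℕ × ℕ × ℕ × ℕ =>
      B p.1 p.2.1 p.2.2.1 p.2.2.2.1 p.2.2.2.2 := by
    have he : Computable fun p : ℕ × ℕ × ℕ × ℕ × ℕ => p.1 := Computable.fst
    have hn : Computable fun p : ℕ × ℕ × ℕ × ℕ × ℕ => p.2.1 := Computable.fst.comp Computable.snd
    have hq : Computable fun p : ℕ × ℕ × ℕ × ℕ × ℕ => p.2.2.1 :=
      Computable.fst.comp (Computable.snd.comp Computable.snd)
    have hu : Computable fun p : ℕ × ℕ × ℕ × ℕ × ℕ => p.2.2.2.1 :=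
      Computable.fst.comp (Computable.snd.comp (Computable.snd.comp Computable.snd))
    have hv : Computable fun p : ℕ × ℕ × ℕ × ℕ × ℕ => p.2.2.2.2 :=
      Computable.snd.comp (Computable.snd.comp (Computable.snd.comp Computable.snd))
    have hi := hu1.comp hq
    have hy := hu1.comp (hu2.comp hq)
    have hz := hu1.comp (hu2.comp (hu2.comp hq))
    have hw := hu2.comp (hu2.comp (hu2.comp hq))
    have ha := hR.comp (he.pair (hi.pair (hy.pair (hz.pair ((hu1.comp hu).pair hv)))))
    have hb := hR.comp (he.pair (hi.pair (hy.pair (hz.pair (hw.pair (hu2.comp hu))))))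
    exact Computable.certCheck hn hi hy hz (Primrec.not.to_comp.comp ha) hb
  let E : ℕ → ℕ → ℕ → ℕ → Bool := fun e n k t =>
    !certCheck k t.unpair.1 t.unpair.2.unpair.1 t.unpair.2.unpair.2
      (B e n t.unpair.1 t.unpair.2.unpair.1 t.unpair.2.unpair.2)
      (!B e n t.unpair.1 t.unpair.2.unpair.1 t.unpair.2.unpair.2)
  refine ⟨E, ?_, fun e => ?_⟩
  · have he : Computable fun p : ℕ × ℕ × ℕ × ℕ => p.1 := Computable.fst
    have hn : Computable fun p : ℕ × ℕ × ℕ × ℕ => p.2.1 := Computable.fst.comp Computable.snd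
    have hk : Computable fun p : ℕ × ℕ × ℕ × ℕ => p.2.2.1 :=
      Computable.fst.comp (Computable.snd.comp Computable.snd)
    have ht : Computable fun p : ℕ × ℕ × ℕ × ℕ => p.2.2.2 :=
      Computable.snd.comp (Computable.snd.comp Computable.snd)
    have hi := hu1.comp ht
    have hy := hu1.comp (hu2.comp ht)
    have hz := hu2.comp (hu2.comp ht)
    have hb := hB.comp (he.pair (hn.pair (hi.pair (hy.pair hz))))
    exact Primrec.not.to_comp.comp
      (Computable.certCheck hk hi hy hz hb (Primrec.not.to_comp.comp hb))
  · have inner : ∀ n, {k | ∀ t, E e n k t = false}.Infinite ↔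
        ∀ q, ∃ u, ∀ v, B e n q u v = true := by
      intro n
      rw [forall_exists_forall_iff_infinite, ← infinite_setOf_ofNat (CertValid _)]
      refine iff_of_eq (congrArg Set.Infinite (Set.ext fun k => ?_))
      simp only [Set.mem_ofPred_eq, E, Bool.not_eq_false', certCheck_iff, CertValid,
        Bool.not_eq_true', Bool.not_eq_true]
      constructor
      · intro h i y z
        simpa using h (Nat.pair i (Nat.pair y z))
      · intro h t
        exact h _ _ _
    have outer : (∀ x, ∃ y, ∀ z, ∃ w, ∀ v, R e x y z w v = false) ↔
        {n | {k | ∀ t, E e n k t = false}.Infinite}.Infinite := by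
      rw [forall_exists_forall_iff_infinite, ← infinite_setOf_ofNat (CertValid _)]
      refine iff_of_eq (congrArg Set.Infinite (Set.ext fun n => ?_))
      simp only [Set.mem_ofPred_eq, inner, CertValid, B, certCheck_iff, Bool.not_eq_true']
      constructor
      · intro h q
        obtain ⟨hp, hn⟩ := h q.unpair.1 q.unpair.2.unpair.1 q.unpair.2.unpair.2.unpair.1
        push Not at hn
        have : ∃ a, certPos (Denumerable.ofNat _ n) q.unpair.1 q.unpair.2.unpair.1
            q.unpair.2.unpair.2.unpair.1 = true → ∀ v, R e q.unpair.1 q.unpair.2.unpair.1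
              q.unpair.2.unpair.2.unpair.1 a v = false := by
          by_cases hc : certPos (Denumerable.ofNat _ n) q.unpair.1 q.unpair.2.unpair.1
            q.unpair.2.unpair.2.unpair.1 = true
          · obtain ⟨a, ha⟩ := hp hc
            exact ⟨a, fun _ => ha⟩
          · exact ⟨0, fun h => absurd h hc⟩
        obtain ⟨a, ha⟩ := this
        have : ∃ b, certNeg (Denumerable.ofNat _ n) q.unpair.1 q.unpair.2.unpair.1
            q.unpair.2.unpair.2.unpair.1 = true → R e q.unpair.1 q.unpair.2.unpair.1
              q.unpair.2.unpair.2.unpair.1 q.unpair.2.unpair.2.unpair.2 b = true := by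
          by_cases hc : certNeg (Denumerable.ofNat _ n) q.unpair.1 q.unpair.2.unpair.1
            q.unpair.2.unpair.2.unpair.1 = true
          · obtain ⟨b, hb⟩ := hn hc q.unpair.2.unpair.2.unpair.2
            exact ⟨b, fun _ => by simpa using hb⟩
          · exact ⟨0, fun h => absurd h hc⟩
        obtain ⟨b, hb⟩ := this
        exact ⟨Nat.pair a b, fun v => by simpa using ⟨fun h => ha h v, hb⟩⟩
      · intro h i y z
        constructor
        · intro hc
          obtain ⟨u, hu⟩ := h (Nat.pair i (Nat.pair y (Nat.pair z 0)))
          simp only [Nat.unpair_pair] at hu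
          exact ⟨u.unpair.1, fun v => (hu v).1 hc⟩
        · rintro hc ⟨w, hw⟩
          obtain ⟨u, hu⟩ := h (Nat.pair i (Nat.pair y (Nat.pair z w)))
          simp only [Nat.unpair_pair] at hu
          simpa [hw] using (hu 0).2 hc
    rw [hPR, ← Set.not_infinite, ← outer]
    push Not
    simp

/-- A uniform form of the fact that semidecidable sets are c.e. -/
theorem exists_wset_index {p : ℕ → ℕ → ℕ → Bool}
    (hp : Computable fun x : ℕ × ℕ × ℕ => p x.1 x.2.1 x.2.2) :
    ∃ g : ℕ → ℕ, Computable g ∧ ∀ e x, x ∈ Wset (g e) ↔ ∃ s, p e x s = true := by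
  have hf : Partrec fun n : ℕ => Nat.rfind fun s =>
      (Part.some (p n.unpair.1 n.unpair.2 s) : Part Bool) := by
    refine Partrec.rfind
      (p := fun (n : ℕ) s => (Part.some (p n.unpair.1 n.unpair.2 s) : Part Bool)) ?_
    have h1 : Computable fun q : ℕ × ℕ => q.1.unpair := Computable.unpair.comp Computable.fst
    have harg : Computable fun q : ℕ × ℕ => (q.1.unpair.1, q.1.unpair.2, q.2) :=
      (Computable.fst.comp h1).pair ((Computable.snd.comp h1).pair Computable.snd)
    have hc : Computable fun q : ℕ × ℕ => p q.1.unpair.1 q.1.unpair.2 q.2 :=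
      (hp.comp harg).of_eq fun _ => rfl
    exact hc.partrec
  obtain ⟨c, hc⟩ := Nat.Partrec.Code.exists_code.1 (Partrec.nat_iff.1 hf)
  refine ⟨fun e => Encodable.encode (Nat.Partrec.Code.curry c e),
    Computable.encode.comp (Nat.Partrec.Code.primrec₂_curry.to_comp.comp (Computable.const c)
      Computable.id), fun e x => ?_⟩
  simp only [Wset, Set.mem_ofPred_eq, Denumerable.ofNat_encode, Nat.Partrec.Code.eval_curry, hc,
    Nat.unpair_pair]
  refine Nat.rfind_dom.trans ?_
  constructor
  · rintro ⟨s, hs, -⟩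
    exact ⟨s, (Part.mem_some_iff.1 hs).symm⟩
  · rintro ⟨s, hs⟩
    exact ⟨s, Part.mem_some_iff.2 hs.symm, fun _ => trivial⟩

/-- An index of the `i`-th column of the c.e. set coded by `a`. -/
def columnIndex (a i : ℕ) : ℕ :=
  Encodable.encode (Nat.Partrec.Code.curry (Denumerable.ofNat Nat.Partrec.Code a) i)

theorem wset_columnIndex (a i : ℕ) : Wset (columnIndex a i) = column a i := by
  ext x
  simp [Wset, column, columnIndex, Nat.Partrec.Code.eval_curry]

theorem computable_columnIndex (a : ℕ) : Computable (columnIndex a) :=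
  Computable.encode.comp (Nat.Partrec.Code.primrec₂_curry.to_comp.comp (Computable.const _)
    Computable.id)

theorem exists_learnerOfCode_eq {M : List ℕ →. ℕ} (hM : Partrec M) :
    ∃ j, learnerOfCode j = M := by
  obtain ⟨c, hc⟩ := Nat.Partrec.Code.exists_code.1 hM
  refine ⟨Encodable.encode c, funext fun σ => ?_⟩
  simp [learnerOfCode, hc, Part.map_id']

section Texts

variable {f : ℕ → ℕ}

theorem length_initSeg (f : ℕ → ℕ) (n : ℕ) : (initSeg f n).length = n := by simp [initSeg]

theorem mem_initSeg {n x : ℕ} : x ∈ initSeg f n ↔ ∃ i < n, f i = x := by simp [initSeg]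

theorem initSeg_prefix {m n : ℕ} (h : m ≤ n) : initSeg f m <+: initSeg f n := by
  obtain ⟨k, rfl⟩ := Nat.exists_eq_add_of_le h
  exact ⟨(List.range k).map fun i => f (m + i), by
    simp [initSeg, List.range_add, Function.comp_def]⟩

theorem eq_initSeg_of_prefix {σ : List ℕ} {n : ℕ} (h : σ <+: initSeg f n) :
    σ = initSeg f σ.length := by
  have hl : σ.length ≤ n := by simpa [length_initSeg] using h.length_le
  exact (List.prefix_of_prefix_length_le h (initSeg_prefix hl)
    (length_initSeg f _).ge).eq_of_length (length_initSeg f _).symm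

/-- A list contained in a nonempty set extends to an enumeration of the set. -/
theorem exists_text_extending {S : Set ℕ} (hS : S.Nonempty) {σ : List ℕ} (hσ : ∀ x ∈ σ, x ∈ S) :
    ∃ f : ℕ → ℕ, Set.range f = S ∧ initSeg f σ.length = σ := by
  obtain ⟨g, rfl⟩ := (Set.to_countable S).exists_eq_range hS
  refine ⟨fun i => if h : i < σ.length then σ[i] else g (i - σ.length), ?_, ?_⟩
  · refine Set.Subset.antisymm ?_ ?_
    · rintro _ ⟨i, rfl⟩
      dsimp only
      split_ifs with h
      · exact hσ _ (List.getElem_mem h)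
      · exact ⟨_, rfl⟩
    · rintro _ ⟨i, rfl⟩
      exact ⟨σ.length + i, by simp⟩
  · refine List.ext_getElem (length_initSeg _ _) fun i hi hi' => ?_
    simp [initSeg, hi']

/-- The union of an increasing chain of lists of unbounded length. -/
theorem exists_text_of_chain {σ : ℕ → List ℕ} (hσ : ∀ s t, s ≤ t → σ s <+: σ t)
    (hl : ∀ n, ∃ s, n < (σ s).length) : ∃ f : ℕ → ℕ, ∀ s, initSeg f (σ s).length = σ s := by
  choose a ha using hl
  refine ⟨fun i => (σ (a i))[i]'(ha i), fun s => ?_⟩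
  refine List.ext_getElem (length_initSeg _ _) fun i hi hi' => ?_
  simp only [initSeg, List.getElem_map, List.getElem_range]
  rcases le_total s (a i) with h | h
  · exact ((hσ _ _ h).getElem hi').symm
  · exact (hσ _ _ h).getElem (ha i)

end Texts

/-- Within `k` steps, the `j`-th learner is seen to answer differently on `σ` and `τ`. -/
def mindChange (j k : ℕ) (σ τ : List ℕ) : Bool :=
  (Nat.Partrec.Code.evaln k (Denumerable.ofNat _ j) (Encodable.encode σ)).isSome &&
  ((Nat.Partrec.Code.evaln k (Denumerable.ofNat _ j) (Encodable.encode τ)).isSome &&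
  !decide (Nat.Partrec.Code.evaln k (Denumerable.ofNat _ j) (Encodable.encode σ) =
    Nat.Partrec.Code.evaln k (Denumerable.ofNat _ j) (Encodable.encode τ)))

theorem exists_ne_of_mindChange {j k : ℕ} {σ τ : List ℕ} (h : mindChange j k σ τ = true) :
    ∃ a ∈ learnerOfCode j σ, ∃ b ∈ learnerOfCode j τ, a ≠ b := by
  simp only [mindChange, Bool.and_eq_true, Bool.not_eq_true', decide_eq_false_iff_not,
    Option.isSome_iff_exists] at h
  obtain ⟨⟨a, ha⟩, ⟨b, hb⟩, hab⟩ := h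
  exact ⟨a, Nat.Partrec.Code.evaln_sound ha, b, Nat.Partrec.Code.evaln_sound hb,
    fun h => hab (by rw [ha, hb, h])⟩

theorem exists_mindChange {j a b : ℕ} {σ τ : List ℕ} (ha : a ∈ learnerOfCode j σ)
    (hb : b ∈ learnerOfCode j τ) (hab : a ≠ b) : ∃ k, mindChange j k σ τ = true := by
  obtain ⟨k, hk⟩ := Nat.Partrec.Code.evaln_complete.1 ha
  obtain ⟨l, hl⟩ := Nat.Partrec.Code.evaln_complete.1 hb
  have hk' := Nat.Partrec.Code.evaln_mono (le_max_left k l) hk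
  have hl' := Nat.Partrec.Code.evaln_mono (le_max_right k l) hl
  rw [Option.mem_def] at hk' hl'
  exact ⟨max k l, by simp [mindChange, hk', hl', hab]⟩

theorem primrec_mindChange : Primrec fun p : (ℕ × ℕ) × List ℕ × List ℕ =>
    mindChange p.1.1 p.1.2 p.2.1 p.2.2 := by
  have h : ∀ {g : (ℕ × ℕ) × List ℕ × List ℕ → List ℕ}, Primrec g → Primrec fun p =>
      Nat.Partrec.Code.evaln p.1.2 (Denumerable.ofNat _ p.1.1) (Encodable.encode (g p)) :=
    fun hg => Nat.Partrec.Code.primrec_evaln.comp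
      (((Primrec.snd.comp Primrec.fst).pair
        ((Primrec.ofNat _).comp (Primrec.fst.comp Primrec.fst))).pair (Primrec.encode.comp hg))
  have h1 := h (Primrec.fst.comp Primrec.snd)
  have h2 := h (Primrec.snd.comp Primrec.snd)
  exact Primrec.and.comp (Primrec.option_isSome.comp h1)
    (Primrec.and.comp (Primrec.option_isSome.comp h2)
      (Primrec.not.comp (Primrec.eq.comp h1 h2).decide))

/-- One stage of the diagonalization against the learner with index `m.unpair.2`. A state consists
of the initial segment `S.1` of a text and of the list `S.2` of all elements of a c.e. set
enumerated so far. Stage `s` searches for a mind change of the learner on extensions of `S.1`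
coded by `s`; the bit `b` tells whether `s.unpair.1` is enumerated. -/
def diagStep (m s : ℕ) (b : Bool) (S : List ℕ × List ℕ) : List ℕ × List ℕ :=
  let d := Denumerable.ofNat ((List ℕ × ℕ) × ℕ × ℕ) s
  let l := bif b then S.2 ++ [Nat.pair m s.unpair.1] else S.2
  (bif mindChange m.unpair.2 d.2.1 (S.1 ++ (d.1.1.take d.1.2).map (Nat.pair m))
      (S.1 ++ d.1.1.map (Nat.pair m)) then S.1 ++ d.1.1.map (Nat.pair m) ++ l else S.1, l)

/-- The diagonalization with marker `m`, where `E` enumerates the c.e. set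
`{k | ∃ t, E (Nat.pair k t)}`. -/
def diag (E : ℕ → Bool) (m : ℕ) : ℕ → List ℕ × List ℕ
  | 0 => ([Nat.pair m 0], [])
  | s + 1 => diagStep m s (E s) (diag E m s)

/-- The set produced by the diagonalization with marker `m`. -/
def diagSet (E : ℕ → Bool) (m : ℕ) : Set ℕ :=
  {x | ∃ s, x ∈ (diag E m s).1 ++ (diag E m s).2}

/-- The set of all numbers with marker `m`. -/
def markedSet (m : ℕ) : Set ℕ := {x | x.unpair.1 = m}

theorem primrec_diagStep : Primrec fun p : (ℕ × ℕ) × Bool × List ℕ × List ℕ =>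
    diagStep p.1.1 p.1.2 p.2.1 p.2.2 := by
  have hm : Primrec fun p : (ℕ × ℕ) × Bool × List ℕ × List ℕ => p.1.1 :=
    Primrec.fst.comp Primrec.fst
  have hs : Primrec fun p : (ℕ × ℕ) × Bool × List ℕ × List ℕ => p.1.2 :=
    Primrec.snd.comp Primrec.fst
  have hb : Primrec fun p : (ℕ × ℕ) × Bool × List ℕ × List ℕ => p.2.1 :=
    Primrec.fst.comp Primrec.snd
  have hS1 : Primrec fun p : (ℕ × ℕ) × Bool × List ℕ × List ℕ => p.2.2.1 :=
    Primrec.fst.comp (Primrec.snd.comp Primrec.snd)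
  have hS2 : Primrec fun p : (ℕ × ℕ) × Bool × List ℕ × List ℕ => p.2.2.2 :=
    Primrec.snd.comp (Primrec.snd.comp Primrec.snd)
  have hd : Primrec fun p : (ℕ × ℕ) × Bool × List ℕ × List ℕ =>
      Denumerable.ofNat ((List ℕ × ℕ) × ℕ × ℕ) p.1.2 := (Primrec.ofNat _).comp hs
  have hτ := Primrec.fst.comp (Primrec.fst.comp hd)
  have hi := Primrec.snd.comp (Primrec.fst.comp hd)
  have hk := Primrec.fst.comp (Primrec.snd.comp hd)
  have htag : ∀ {g : (ℕ × ℕ) × Bool × List ℕ × List ℕ → List ℕ}, Primrec g →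
      Primrec fun p => (g p).map (Nat.pair p.1.1) := fun hg =>
    Primrec.list_map hg (Primrec₂.natPair.comp (hm.comp Primrec.fst) Primrec.snd)
  have hl : Primrec fun p : (ℕ × ℕ) × Bool × List ℕ × List ℕ =>
      bif p.2.1 then p.2.2.2 ++ [Nat.pair p.1.1 p.1.2.unpair.1] else p.2.2.2 :=
    Primrec.cond hb (Primrec.list_concat.comp hS2
      (Primrec₂.natPair.comp hm (Primrec.fst.comp (Primrec.unpair.comp hs)))) hS2
  have hlong := Primrec.list_append.comp hS1 (htag hτ)
  have hshort := Primrec.list_append.comp hS1 (htag (Primrec.list_take.comp hi hτ))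
  have hj := Primrec.snd.comp (Primrec.unpair.comp hm)
  exact (Primrec.cond (primrec_mindChange.comp ((hj.pair hk).pair (hshort.pair hlong)))
    (Primrec.list_append.comp hlong hl) hS1).pair hl

theorem Computable.diag {α : Type*} [Primcodable α] {E : α → ℕ → Bool} {m s : α → ℕ}
    (hE : Computable₂ E) (hm : Computable m) (hs : Computable s) :
    Computable fun a => diag (E a) (m a) (s a) := by
  have h0 : Computable fun a => (([Nat.pair (m a) 0], []) : List ℕ × List ℕ) :=
    (Computable.list_cons.comp (Primrec₂.natPair.to_comp.comp hm (Computable.const 0))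
      (Computable.const [])).pair (Computable.const [])
  have h1 : Computable₂ fun a (p : ℕ × List ℕ × List ℕ) => diagStep (m a) p.1 (E a p.1) p.2 := by
    have hp : Computable fun q : α × ℕ × List ℕ × List ℕ => q.2.1 :=
      Computable.fst.comp Computable.snd
    have harg : Computable fun q : α × ℕ × List ℕ × List ℕ =>
        ((m q.1, q.2.1), E q.1 q.2.1, q.2.2) :=
      ((hm.comp Computable.fst).pair hp).pair
        ((hE.comp Computable.fst hp).pair (Computable.snd.comp Computable.snd))
    exact (primrec_diagStep.to_comp.comp harg).of_eq fun _ => rfl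
  refine (Computable.nat_rec hs h0 h1).of_eq fun a => ?_
  induction s a with
  | zero => rfl
  | succ n ih => simp only [_root_.diag, ← ih]

section Diagonalization

variable {E : ℕ → Bool} {m : ℕ}

theorem diag_prefix {s t : ℕ} (h : s ≤ t) : (diag E m s).1 <+: (diag E m t).1 := by
  induction t, h using Nat.le_induction with
  | base => exact List.prefix_rfl
  | succ t _ ih =>
    refine ih.trans ?_
    simp only [diag, diagStep]
    cases mindChange _ _ _ _
    · exact List.prefix_rfl
    · simp only [cond_true, List.append_assoc]
      exact List.prefix_append _ _

theorem diag_snd_prefix {s t : ℕ} (h : s ≤ t) : (diag E m s).2 <+: (diag E m t).2 := by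
  induction t, h using Nat.le_induction with
  | base => exact List.prefix_rfl
  | succ t _ ih =>
    refine ih.trans ?_
    simp only [diag, diagStep]
    cases E t
    · exact List.prefix_rfl
    · exact List.prefix_append _ _

theorem diagSet_subset : diagSet E m ⊆ markedSet m := by
  rintro x ⟨s, hs⟩
  have key : ∀ s, (∀ x ∈ (diag E m s).1, x ∈ markedSet m) ∧
      ∀ x ∈ (diag E m s).2, x ∈ markedSet m := by
    intro s
    induction s with
    | zero => simp [diag, markedSet]
    | succ s ih =>
      obtain ⟨h1, h2⟩ := ih
      have h3 : ∀ x ∈ (diag E m (s + 1)).2, x ∈ markedSet m := by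
        simp only [diag, diagStep]
        cases E s
        · exact h2
        · intro x hx
          simp only [cond_true, List.mem_append, List.mem_singleton] at hx
          rcases hx with hx | rfl
          · exact h2 x hx
          · simp [markedSet]
      refine ⟨?_, h3⟩
      simp only [diag, diagStep] at h3 ⊢
      cases mindChange _ _ _ _
      · exact h1
      · intro x hx
        simp only [cond_true, List.mem_append] at hx
        rcases hx with (hx | hx) | hx
        · exact h1 x hx
        · obtain ⟨y, -, rfl⟩ := List.mem_map.1 hx
          simp [markedSet]
        · exact h3 x hx
  rcases List.mem_append.1 hs with h | h
  · exact (key s).1 x h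
  · exact (key s).2 x h

theorem pair_mem_diagSet {k t : ℕ} (h : E (Nat.pair k t) = true) :
    Nat.pair m k ∈ diagSet E m :=
  ⟨Nat.pair k t + 1, List.mem_append_right _ (by simp [diag, diagStep, h])⟩

theorem mem_diag_snd {s x : ℕ} (h : x ∈ (diag E m s).2) :
    ∃ k t, E (Nat.pair k t) = true ∧ x = Nat.pair m k := by
  induction s with
  | zero => simp [diag] at h
  | succ s ih =>
    simp only [diag, diagStep] at h
    cases hE : E s
    · exact ih (by simpa [hE] using h)
    · simp only [hE, cond_true, List.mem_append, List.mem_singleton] at h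
      rcases h with h | rfl
      · exact ih h
      · exact ⟨_, s.unpair.2, by simpa using hE, rfl⟩

theorem diagSet_nonempty : (diagSet E m).Nonempty :=
  ⟨Nat.pair m 0, 0, by simp [diag]⟩

/-- If the enumerated set is cofinite, the diagonalization is almost all of `markedSet m`. -/
theorem finite_markedSet_diff (h : {k | ∀ t, E (Nat.pair k t) = false}.Finite) :
    (markedSet m \ diagSet E m).Finite := by
  refine (h.image (Nat.pair m)).subset ?_
  rintro x ⟨hx, hx'⟩
  have hx : x.unpair.1 = m := hx
  refine ⟨x.unpair.2, fun t => ?_, by rw [← hx, Nat.pair_unpair]⟩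
  by_contra hE
  refine hx' ?_
  have := pair_mem_diagSet (m := m) (by simpa using hE)
  rwa [← hx, Nat.pair_unpair, hx] at this

/-- If infinitely many stages find a mind change, the learner has a text for `diagSet E m` on which
it does not converge. -/
theorem not_learns_of_changes
    (h : ∀ s₀, ∃ s ≥ s₀, (diag E m (s + 1)).1 ≠ (diag E m s).1) :
    ¬ TxtExStarLearnsSet (learnerOfCode m.unpair.2) (diagSet E m) := by
  intro hM
  have hstep : ∀ s, (diag E m (s + 1)).1 ≠ (diag E m s).1 → ∃ ρ τ,
      (diag E m s).1 <+: ρ ∧ ρ <+: τ ∧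
      (diag E m (s + 1)).1 = τ ++ (diag E m (s + 1)).2 ∧
      ∃ k, mindChange m.unpair.2 k ρ τ = true := by
    intro s hs
    have hc : mindChange m.unpair.2 (Denumerable.ofNat ((List ℕ × ℕ) × ℕ × ℕ) s).2.1
        ((diag E m s).1 ++ ((Denumerable.ofNat ((List ℕ × ℕ) × ℕ × ℕ) s).1.1.take
          (Denumerable.ofNat ((List ℕ × ℕ) × ℕ × ℕ) s).1.2).map (Nat.pair m))
        ((diag E m s).1 ++ (Denumerable.ofNat ((List ℕ × ℕ) × ℕ × ℕ) s).1.1.map (Nat.pair m))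
          = true := by
      by_contra hc
      rw [Bool.not_eq_true] at hc
      exact hs (by simp only [diag, diagStep, hc, cond_false])
    refine ⟨_, _, List.prefix_append _ _, (List.prefix_append_right_inj _).2
      ((List.take_prefix _ _).map (Nat.pair m)), ?_, _, hc⟩
    simp only [diag, diagStep, hc, cond_true]
  have hgrow : ∀ n, ∃ s, n < (diag E m s).1.length := by
    intro n
    induction n with
    | zero => exact ⟨0, by simp [diag]⟩
    | succ n ih =>
      obtain ⟨s₀, hs₀⟩ := ih
      obtain ⟨s, hs, hne⟩ := h s₀
      refine ⟨s + 1, ?_⟩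
      have h1 := (diag_prefix (E := E) (m := m) hs).length_le
      have h2 := diag_prefix (E := E) (m := m) (Nat.le_succ s)
      have h3 : (diag E m s).1.length ≠ (diag E m (s + 1)).1.length :=
        fun hl => hne (h2.eq_of_length hl).symm
      have h4 := h2.length_le
      simp only [Nat.succ_eq_add_one] at h4
      omega
  obtain ⟨f, hf⟩ := exists_text_of_chain (σ := fun s => (diag E m s).1)
    (fun s t => diag_prefix) hgrow
  have hrange : Set.range f = diagSet E m := by
    refine Set.Subset.antisymm ?_ ?_
    · rintro _ ⟨i, rfl⟩
      obtain ⟨s, hs⟩ := hgrow i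
      refine ⟨s, List.mem_append_left _ ?_⟩
      rw [← hf s]
      exact mem_initSeg.2 ⟨i, hs, rfl⟩
    · rintro x ⟨s, hs⟩
      have : ∃ t, x ∈ (diag E m t).1 := by
        rcases List.mem_append.1 hs with hx | hx
        · exact ⟨s, hx⟩
        · obtain ⟨t, ht, hne⟩ := h s
          obtain ⟨ρ, τ, -, -, heq, -⟩ := hstep t hne
          refine ⟨t + 1, ?_⟩
          rw [heq]
          exact List.mem_append_right _ ((diag_snd_prefix (by omega)).subset hx)
      obtain ⟨t, ht⟩ := this
      rw [← hf t] at ht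
      obtain ⟨i, -, hi⟩ := mem_initSeg.1 ht
      exact ⟨i, hi⟩
  obtain ⟨n, ⟨N, hN⟩, -⟩ := hM f hrange
  obtain ⟨s₀, hs₀⟩ := hgrow N
  obtain ⟨s, hs, hne⟩ := h s₀
  obtain ⟨ρ, τ, h1, h2, heq, k, hk⟩ := hstep s hne
  have hτ : τ <+: initSeg f (diag E m (s + 1)).1.length := by
    rw [hf (s + 1)]
    rw [heq]
    exact List.prefix_append _ _
  have hl := (diag_prefix (E := E) (m := m) hs).length_le
  have hl1 := h1.length_le
  have hl2 := h2.length_le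
  obtain ⟨a, ha, b, hb, hab⟩ := exists_ne_of_mindChange hk
  rw [eq_initSeg_of_prefix hτ, hN _ (by omega), Part.mem_some_iff] at hb
  rw [eq_initSeg_of_prefix (h2.trans hτ), hN _ (by omega), Part.mem_some_iff] at ha
  exact hab (ha.trans hb.symm)

/-- If no stage after `s₀` finds a mind change, there is no mind change between extensions of the
initial segment. -/
theorem mindChange_of_stable {s₀ k : ℕ}
    (h : ∀ s ≥ s₀, (diag E m (s + 1)).1 = (diag E m s).1) {ρ τ : List ℕ}
    (h1 : (diag E m s₀).1 <+: ρ) (h2 : ρ <+: τ) (h3 : ∀ x ∈ τ, x ∈ markedSet m)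
    (hk : mindChange m.unpair.2 k ρ τ = true) : False := by
  have hst : ∀ s ≥ s₀, (diag E m s).1 = (diag E m s₀).1 := by
    intro s hs
    induction s, hs using Nat.le_induction with
    | base => rfl
    | succ t ht ih => rw [h t ht, ih]
  obtain ⟨a, rfl⟩ := h1
  obtain ⟨b, rfl⟩ := h2
  let τ' : List ℕ := (a ++ b).map fun x => x.unpair.2
  have hτ' : τ'.map (Nat.pair m) = a ++ b := by
    simp only [τ', List.map_map]
    conv_rhs => rw [← List.map_id (a ++ b)]
    refine List.map_congr_left fun x hx => ?_
    have hx : x.unpair.1 = m := h3 x (by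
      rw [List.append_assoc]; exact List.mem_append_right _ hx)
    simp only [Function.comp, id, ← hx, Nat.pair_unpair]
  have htake : (τ'.take a.length).map (Nat.pair m) = a := by
    rw [List.map_take, hτ', List.take_left]
  let s := Encodable.encode ((τ', a.length), k, s₀)
  have hs : s₀ ≤ s := (Nat.right_le_pair _ _).trans (Nat.right_le_pair _ _)
  have hd : Denumerable.ofNat ((List ℕ × ℕ) × ℕ × ℕ) s = ((τ', a.length), k, s₀) :=
    Denumerable.ofNat_encode _
  have hstage := h s hs
  rw [diag, diagStep, hd, hst s hs] at hstage
  dsimp only at hstage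
  rw [htake, hτ', ← List.append_assoc, hk, cond_true] at hstage
  have hnil : a ++ b = [] := by
    have := congrArg List.length hstage
    simp only [List.length_append] at this
    refine List.length_eq_zero_iff.1 ?_
    rw [List.length_append]
    omega
  obtain ⟨x, hx, y, hy, hxy⟩ := exists_ne_of_mindChange hk
  obtain ⟨rfl, rfl⟩ := List.append_eq_nil_iff.1 hnil
  simp only [List.append_nil] at hx hy
  exact hxy (Part.mem_unique hx hy)

/-- If the enumerated set is coinfinite, the learner with index `m.unpair.2` fails on `diagSet E m`
or on `markedSet m`. -/
theorem not_learns_diagSet_and_markedSet (hE : {k | ∀ t, E (Nat.pair k t) = false}.Infinite) :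
    ¬ (TxtExStarLearnsSet (learnerOfCode m.unpair.2) (diagSet E m) ∧
      TxtExStarLearnsSet (learnerOfCode m.unpair.2) (markedSet m)) := by
  rintro ⟨hA, hN⟩
  by_cases h : ∀ s₀, ∃ s ≥ s₀, (diag E m (s + 1)).1 ≠ (diag E m s).1
  · exact not_learns_of_changes h hA
  push Not at h
  obtain ⟨s₀, h⟩ := h
  obtain ⟨f₁, hf₁, hi₁⟩ := exists_text_extending (diagSet_nonempty (E := E) (m := m))
    (σ := (diag E m s₀).1) fun x hx => ⟨s₀, List.mem_append_left _ hx⟩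
  obtain ⟨n₁, ⟨N₁, hN₁⟩, hfin₁⟩ := hA f₁ hf₁
  rw [hf₁] at hfin₁
  let l := max N₁ (diag E m s₀).1.length
  obtain ⟨f₂, hf₂, hi₂⟩ := exists_text_extending
    (diagSet_nonempty.mono (diagSet_subset (E := E) (m := m))) (σ := initSeg f₁ l) fun x hx => by
      obtain ⟨i, -, rfl⟩ := mem_initSeg.1 hx
      exact diagSet_subset (hf₁ ▸ Set.mem_range_self i)
  obtain ⟨n₂, ⟨N₂, hN₂⟩, hfin₂⟩ := hN f₂ hf₂
  rw [hf₂] at hfin₂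
  have hn : n₁ = n₂ := by
    by_contra hne
    have ha : n₁ ∈ learnerOfCode m.unpair.2 (initSeg f₁ l) := by
      rw [hN₁ l (le_max_left _ _)]
      exact Part.mem_some _
    have hb : n₂ ∈ learnerOfCode m.unpair.2 (initSeg f₂ (max N₂ l)) := by
      rw [hN₂ _ (le_max_left _ _)]
      exact Part.mem_some _
    obtain ⟨k, hk⟩ := exists_mindChange ha hb hne
    refine mindChange_of_stable h ?_ ?_ ?_ hk
    · conv_lhs => rw [← hi₁]
      exact initSeg_prefix (le_max_right _ _)
    · conv_lhs => rw [← hi₂, length_initSeg]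
      exact initSeg_prefix (le_max_right _ _)
    · intro x hx
      obtain ⟨i, -, rfl⟩ := mem_initSeg.1 hx
      exact hf₂ ▸ Set.mem_range_self i
  subst hn
  have hdiff : (markedSet m \ diagSet E m).Finite := by
    refine (hfin₁.union hfin₂).subset ?_
    rintro x ⟨hx, hx'⟩
    by_cases hw : x ∈ Wset n₁
    · exact Or.inl (Or.inl ⟨hw, hx'⟩)
    · exact Or.inr (Or.inr ⟨hx, hw⟩)
  refine hE (Set.Finite.of_finite_image ((hdiff.union
    (List.finite_toSet (diag E m s₀).1)).subset ?_) (f := Nat.pair m) fun a _ b _ hab => ?_)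
  · rintro _ ⟨k, hk, rfl⟩
    by_cases hmem : Nat.pair m k ∈ (diag E m s₀).1
    · exact Or.inr hmem
    refine Or.inl ⟨by simp [markedSet], ?_⟩
    rintro ⟨s, hs⟩
    rcases List.mem_append.1 hs with hs | hs
    · have hst : ∀ t ≥ s₀, (diag E m t).1 = (diag E m s₀).1 := by
        intro t ht
        induction t, ht using Nat.le_induction with
        | base => rfl
        | succ t ht ih => rw [h t ht, ih]
      have := (diag_prefix (E := E) (m := m) (le_max_left s s₀)).subset hs
      rw [hst _ (le_max_right _ _)] at this
      exact hmem this
    · obtain ⟨k', t, hE', heq⟩ := mem_diag_snd hs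
      rw [(Nat.pair_eq_pair.1 heq).2] at hk
      exact absurd (hk t) (by simp [hE'])
  · exact (Nat.pair_eq_pair.1 hab).2

end Diagonalization

/-- The family of all sets `markedSet m` and `A m ⊆ markedSet m` is learnable if the two sets are
almost equal for all but finitely many `m`. -/
theorem exists_learner_of_finite {A : ℕ → Set ℕ} (hA : ∀ m, A m ⊆ markedSet m) {u v : ℕ → ℕ}
    (hu : Computable u) (hv : Computable v) (hu' : ∀ m, Wset (u m) = markedSet m)
    (hv' : ∀ m, Wset (v m) = A m) (hfin : {m | (markedSet m \ A m).Infinite}.Finite) :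
    ∃ M : List ℕ →. ℕ, Partrec M ∧
      ∀ m, TxtExStarLearnsSet M (A m) ∧ TxtExStarLearnsSet M (markedSet m) := by
  have hD : ∃ D : List ℕ, (∀ d ∈ D, d ∉ A d.unpair.1) ∧
      ∀ m, (∀ d ∈ D, d.unpair.1 ≠ m) → (markedSet m \ A m).Finite := by
    have : ∀ m ∈ {m | (markedSet m \ A m).Infinite}, ∃ d, d ∈ markedSet m \ A m :=
      fun m hm => Set.Infinite.nonempty hm
    choose! d hd using this
    refine ⟨hfin.toFinset.toList.map d, fun x hx => ?_, fun m hm => ?_⟩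
    · simp only [List.mem_map, Finset.mem_toList, Set.Finite.mem_toFinset] at hx
      obtain ⟨m, hm, rfl⟩ := hx
      obtain ⟨h1, h2⟩ := hd m hm
      have h1 : (d m).unpair.1 = m := h1
      rwa [h1]
    · by_contra hinf
      refine hm (d m) ?_ (hd m hinf).1
      simp only [List.mem_map, Finset.mem_toList, Set.Finite.mem_toFinset]
      exact ⟨m, hinf, rfl⟩
  obtain ⟨D, hD1, hD2⟩ := hD
  let c : List ℕ → Bool := fun σ =>
    decide (∃ d ∈ D, d.unpair.1 = σ.headI.unpair.1) && decide (∀ d ∈ D, ¬ ∃ x ∈ σ, x = d)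
  let M : List ℕ → ℕ := fun σ => bif c σ then v σ.headI.unpair.1 else u σ.headI.unpair.1
  have hc : Computable c := by
    have h1 : PrimrecRel fun d k : ℕ => d.unpair.1 = k :=
      Primrec.eq.comp (Primrec.fst.comp (Primrec.unpair.comp Primrec.fst)) Primrec.snd
    have h2 : PrimrecRel fun (d : ℕ) (σ : List ℕ) => ¬ ∃ x ∈ σ, x = d :=
      ((PrimrecRel.exists_mem_list Primrec.eq).comp Primrec.snd Primrec.fst).not
    have h3 := ((PrimrecRel.exists_mem_list h1).comp (Primrec.const D)
      (Primrec.fst.comp (Primrec.unpair.comp Primrec.list_headI))).decide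
    have h4 := ((PrimrecRel.forall_mem_list h2).comp (Primrec.const D) Primrec.id).decide
    exact (Primrec.and.comp h3 h4).to_comp
  have hhead : Computable fun σ : List ℕ => σ.headI.unpair.1 :=
    (Primrec.fst.comp (Primrec.unpair.comp Primrec.list_headI)).to_comp
  have hM : Computable M := Computable.cond hc (hv.comp hhead) (hu.comp hhead)
  have hM_apply : ∀ {f : ℕ → ℕ} {m : ℕ}, Set.range f ⊆ markedSet m → ∀ i ≥ 1,
      M (initSeg f i) = bif decide (∃ d ∈ D, d.unpair.1 = m) &&
        decide (∀ d ∈ D, ¬ ∃ x ∈ initSeg f i, x = d) then v m else u m := by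
    intro f m hf i hi
    have : (initSeg f i).headI.unpair.1 = m := by
      obtain ⟨k, rfl⟩ := Nat.exists_eq_add_of_le' hi
      simp only [initSeg, List.range_succ_eq_map, List.map_cons, List.headI_cons]
      exact hf (Set.mem_range_self 0)
    simp only [M, c, this]
  refine ⟨M, hM, fun m => ⟨fun f hf => ?_, fun f hf => ?_⟩⟩
  · have happ := hM_apply (hf.subset.trans (hA m))
    by_cases hm : ∃ d ∈ D, d.unpair.1 = m
    · refine ⟨v m, ⟨1, fun i hi => congrArg Part.some ?_⟩, by simp [hv', hf]⟩
      have : ∀ d ∈ D, ¬ ∃ x ∈ initSeg f i, x = d := by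
        rintro d hd ⟨x, hx, rfl⟩
        obtain ⟨k, -, rfl⟩ := mem_initSeg.1 hx
        have hk : f k ∈ A m := hf ▸ Set.mem_range_self k
        have hk' : (f k).unpair.1 = m := hA m hk
        exact hD1 _ hd (by rwa [hk'])
      rw [happ i hi, decide_eq_true hm, decide_eq_true this, Bool.and_self, cond_true]
    · refine ⟨u m, ⟨1, fun i hi => congrArg Part.some ?_⟩, ?_⟩
      · rw [happ i hi, decide_eq_false hm, Bool.false_and, cond_false]
      · rw [hu', hf, Set.symmDiff_def, Set.sdiff_eq_empty.2 (hA m), Set.union_empty]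
        exact hD2 m fun d hd h => hm ⟨d, hd, h⟩
  · have happ := hM_apply hf.subset
    by_cases hm : ∃ d ∈ D, d.unpair.1 = m
    · obtain ⟨d, hd, hdm⟩ := hm
      obtain ⟨k, hk⟩ : d ∈ Set.range f := hf ▸ hdm
      refine ⟨u m, ⟨k + 1, fun i hi => congrArg Part.some ?_⟩, by simp [hu', hf]⟩
      have : ¬ ∀ d ∈ D, ¬ ∃ x ∈ initSeg f i, x = d :=
        fun h => h d hd ⟨d, mem_initSeg.2 ⟨k, by omega, hk⟩, rfl⟩
      rw [happ i (by omega), decide_eq_false this, Bool.and_false, cond_false]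
    · refine ⟨u m, ⟨1, fun i hi => congrArg Part.some ?_⟩, by simp [hu', hf]⟩
      rw [happ i hi, decide_eq_false hm, Bool.false_and, cond_false]

/-- EXL* is Σ⁰₅-hard. -/
theorem EXLstar_sigma5_hard :
    ∀ P : Set ℕ, IsSigma5 P →
      ∃ g : ℕ → ℕ, Computable g ∧ ∀ e, e ∈ P ↔ g e ∈ EXLstar := by
  intro P hP
  obtain ⟨E, hE, hPE⟩ := hP.exists_cofinite_form
  have hu1 : Primrec fun n : ℕ => n.unpair.1 := Primrec.fst.comp Primrec.unpair
  have hu2 : Primrec fun n : ℕ => n.unpair.2 := Primrec.snd.comp Primrec.unpair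
  obtain ⟨F, hF, hFE⟩ : ∃ F : ℕ → ℕ → ℕ → Bool,
      Computable (fun q : (ℕ × ℕ) × ℕ => F q.1.1 q.1.2 q.2) ∧ ∀ e m s, F e m s =
        (E e m.unpair.1 s.unpair.1 s.unpair.2 || decide (m.unpair.1 < m.unpair.2)) := by
    refine ⟨fun e m s =>
      E e m.unpair.1 s.unpair.1 s.unpair.2 || decide (m.unpair.1 < m.unpair.2), ?_,
      fun _ _ _ => rfl⟩
    have he : Computable fun q : (ℕ × ℕ) × ℕ => q.1.1 := Computable.fst.comp Computable.fst
    have hm : Primrec fun q : (ℕ × ℕ) × ℕ => q.1.2 := Primrec.snd.comp Primrec.fst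
    have hs : Computable fun q : (ℕ × ℕ) × ℕ => q.2 := Computable.snd
    have h1 := hE.comp (he.pair ((hu1.to_comp.comp hm.to_comp).pair
      ((hu1.to_comp.comp hs).pair (hu2.to_comp.comp hs))))
    exact Primrec.or.to_comp.comp h1
      (Primrec.nat_lt.comp (hu1.comp hm) (hu2.comp hm)).decide.to_comp
  let p : ℕ → ℕ → ℕ → Bool := fun e y s =>
    decide (y.unpair.2.unpair.1 = y.unpair.1.unpair.1) &&
      (decide (y.unpair.1.unpair.2 = 0) ||
        decide (∃ x ∈ (diag (F e y.unpair.1.unpair.1) y.unpair.1.unpair.1 s).1 ++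
          (diag (F e y.unpair.1.unpair.1) y.unpair.1.unpair.1 s).2, x = y.unpair.2))
  have hp : Computable fun x : ℕ × ℕ × ℕ => p x.1 x.2.1 x.2.2 := by
    have hy : Primrec fun x : ℕ × ℕ × ℕ => x.2.1 := Primrec.fst.comp Primrec.snd
    have hx := hu2.comp hy
    have hm := hu1.comp (hu1.comp hy)
    have hs : Computable fun x : ℕ × ℕ × ℕ => x.2.2 := Computable.snd.comp Computable.snd
    have h1 := (Primrec.eq.comp (hu1.comp hx) hm).decide.to_comp
    have h2 := (Primrec.eq.comp (hu2.comp (hu1.comp hy)) (Primrec.const 0)).decide.to_comp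
    have harg : Computable fun q : (ℕ × ℕ × ℕ) × ℕ => (q.1.1, q.1.2.1.unpair.1.unpair.1) :=
      (Computable.fst.pair hm.to_comp).comp Computable.fst
    have hG : Computable₂ fun (x : ℕ × ℕ × ℕ) s => F x.1 x.2.1.unpair.1.unpair.1 s :=
      (hF.comp (harg.pair Computable.snd)).of_eq fun _ => rfl
    have hd := Computable.diag hG hm.to_comp hs
    have hl := Computable.list_append.comp (Computable.fst.comp hd) (Computable.snd.comp hd)
    have hmem : Computable₂ fun (l : List ℕ) b => decide (∃ x ∈ l, x = b) :=
      (PrimrecRel.exists_mem_list (Primrec.eq (α := ℕ))).decide.to_comp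
    have h3 := hmem.comp hl hx.to_comp
    exact Primrec.and.to_comp.comp h1 (Primrec.or.to_comp.comp h2 h3)
  obtain ⟨g, hg, hW⟩ := exists_wset_index hp
  have hcol0 : ∀ e m, column (g e) (Nat.pair m 0) = markedSet m := by
    intro e m
    ext x
    simp [column, hW, p, markedSet]
  have hcol1 : ∀ e m b, column (g e) (Nat.pair m (b + 1)) = diagSet (F e m) m := by
    intro e m b
    ext x
    have : x ∈ diagSet (F e m) m ↔ x.unpair.1 = m ∧ x ∈ diagSet (F e m) m :=
      ⟨fun h => ⟨diagSet_subset h, h⟩, And.right⟩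
    rw [this]
    simp [column, hW, p, diagSet]
  refine ⟨g, hg, fun e => ?_⟩
  constructor
  · intro he
    have hfin : {m | (markedSet m \ diagSet (F e m) m).Infinite}.Finite := by
      refine (((hPE e).1 he).biUnion fun n _ =>
        (Set.finite_Iic n).image (Nat.pair n)).subset fun m hm => ?_
      have hm : {k | ∀ t, F e m (Nat.pair k t) = false}.Infinite :=
        fun h => hm (finite_markedSet_diff h)
      have hle : m.unpair.2 ≤ m.unpair.1 := by
        obtain ⟨k, hk⟩ := hm.nonempty
        have := hk 0
        simp only [hFE, Bool.or_eq_false_iff, decide_eq_false_iff_not, not_lt] at this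
        exact this.2
      refine Set.mem_biUnion (x := m.unpair.1) (hm.mono fun k hk t => ?_)
        ⟨m.unpair.2, hle, Nat.pair_unpair m⟩
      have := hk t
      simp only [hFE, Bool.or_eq_false_iff, Nat.unpair_pair] at this
      exact this.1
    obtain ⟨M, hM, hML⟩ := exists_learner_of_finite (fun m => diagSet_subset)
      (u := fun m => columnIndex (g e) (Nat.pair m 0))
      (v := fun m => columnIndex (g e) (Nat.pair m 1))
      ((computable_columnIndex _).comp
        (Primrec₂.natPair.to_comp.comp Computable.id (Computable.const 0)))
      ((computable_columnIndex _).comp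
        (Primrec₂.natPair.to_comp.comp Computable.id (Computable.const 1)))
      (fun m => by rw [wset_columnIndex, hcol0])
      (fun m => by rw [wset_columnIndex, hcol1]) hfin
    refine ⟨M, hM, fun i => ?_⟩
    rw [← Nat.pair_unpair i]
    cases i.unpair.2 with
    | zero => rw [hcol0]; exact (hML _).2
    | succ b => rw [hcol1]; exact (hML _).1
  · rintro ⟨M, hM, hML⟩
    by_contra he
    obtain ⟨j, rfl⟩ := exists_learnerOfCode_eq hM
    have hinf : {n | {k | ∀ t, E e n k t = false}.Infinite}.Infinite := fun h => he ((hPE e).2 h)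
    obtain ⟨n, hn, hjn⟩ := hinf.exists_gt j
    refine not_learns_diagSet_and_markedSet (E := F e (Nat.pair n j)) (m := Nat.pair n j)
      (Set.Infinite.mono (fun k hk t => ?_) hn) ⟨?_, ?_⟩
    · simp only [hFE, Nat.unpair_pair, hk t, Bool.false_or, decide_eq_false_iff_not]
      omega
    · rw [Nat.unpair_pair, ← hcol1 e _ 0]
      exact hML _
    · rw [Nat.unpair_pair, ← hcol0 e]
      exact hML _
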